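/- arXiv:2403.06337 — 2 statements merged into one kernel-verified Lean document; each statement's English description precedes it below -/
import Mathlib

section
/- Let L ≥ 1, let u_l < u_h be reals, let σ > 0, and let A be the shift-domain beamforming matrix associated with u_l, u_h. Let n_0,…,n_{N−1} be zero-mean uncorrelated complex noise random variables of variance σ², let N̄(w) be the beamformed spatially smoothed noise matrix, and let SNR(u,w) be the effective SNR for a target of nonzero amplitude x ∈ ℂ at reduced angle u. Then for every nonzero w ∈ ℂ^L and every unit-norm eigenvector w_o of A associated with its largest eigenvalue, ∫_{u_l}^{u_h} SNR(u, w) du ≤ ∫_{u_l}^{u_h} SNR(u, w_o) du; i.e., the top eigenvector of A maximizes the integrated effective SNR over the angular region of interest. -/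
open MeasureTheory Complex

/-- The shift-domain beamforming matrix `A` associated with `u_l < u_h`:
`[A]_{m,m'} = (exp(i(m−m')u_h) − exp(i(m−m')u_l))/(i(m−m'))` for `m ≠ m'`,
and `[A]_{m,m} = u_h − u_l`. -/
noncomputable def bfMatrix (L : ℕ) (ul uh : ℝ) : Matrix (Fin L) (Fin L) ℂ :=
  Matrix.of fun m m' =>
    if m = m' then ((uh - ul : ℝ) : ℂ)
    else (Complex.exp (Complex.I * (((m : ℕ) : ℂ) - ((m' : ℕ) : ℂ)) * (uh : ℂ)) -
          Complex.exp (Complex.I * (((m : ℕ) : ℂ) - ((m' : ℕ) : ℂ)) * (ul : ℂ))) /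
      (Complex.I * (((m : ℕ) : ℂ) - ((m' : ℕ) : ℂ)))

/-- `E[‖N̄(w)‖_F²]`, the expected squared Frobenius norm of the beamformed spatially
smoothed noise matrix `N̄(w) = Σ_l conj(w_l)·N_l`, where `[N_l]_{m,p} = n_{d_m + p + l}`
(0-based `p`, `l`). -/
noncomputable def noiseEnergy {Ω : Type*} [MeasureSpace Ω] (L Nb P : ℕ)
    (d : Fin Nb → ℕ) (n : ℕ → Ω → ℂ) (w : Fin L → ℂ) : ℝ :=
  ∫ ω, ∑ m : Fin Nb, ∑ p : Fin P,
    Complex.normSq (∑ l : Fin L, (starRingEnd ℂ) (w l) * n (d m + (p : ℕ) + (l : ℕ)) ω)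

/-- The effective SNR `SNR(u,w) = ‖x · a_{S_b}(u) · (wᴴa(u)) · a_{Δ1}(u)ᵀ‖_F² / E[‖N̄(w)‖_F²]`. -/
noncomputable def effSNR {Ω : Type*} [MeasureSpace Ω] (L Nb P : ℕ)
    (d : Fin Nb → ℕ) (n : ℕ → Ω → ℂ) (x : ℂ) (u : ℝ) (w : Fin L → ℂ) : ℝ :=
  (∑ m : Fin Nb, ∑ p : Fin P,
      Complex.normSq (x * Complex.exp (Complex.I * ((d m : ℕ) : ℂ) * (u : ℂ)) *
        (∑ l : Fin L, (starRingEnd ℂ) (w l) *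
          Complex.exp (Complex.I * ((l : ℕ) : ℂ) * (u : ℂ))) *
        Complex.exp (Complex.I * ((p : ℕ) : ℂ) * (u : ℂ)))) /
    noiseEnergy L Nb P d n w

theorem ofReal_normSq_sum_conj_mul {L : ℕ} (w z : Fin L → ℂ) :
    ((Complex.normSq (∑ l, (starRingEnd ℂ) (w l) * z l) : ℝ) : ℂ) =
      ∑ l, ∑ k, (starRingEnd ℂ) (w l) * w k * ((starRingEnd ℂ) (z k) * z l) := by
  rw [← Complex.mul_conj, map_sum, Finset.sum_mul_sum]
  refine Finset.sum_congr rfl fun l _ => Finset.sum_congr rfl fun k _ => ?_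
  simp only [map_mul, Complex.conj_conj]
  ring

theorem conj_exp_mul_exp (a b : ℕ) (u : ℝ) :
    (starRingEnd ℂ) (Complex.exp (Complex.I * (b : ℂ) * (u : ℂ))) *
        Complex.exp (Complex.I * (a : ℂ) * (u : ℂ)) =
      Complex.exp (Complex.I * ((a : ℂ) - (b : ℂ)) * (u : ℂ)) := by
  rw [← Complex.exp_conj, ← Complex.exp_add]
  congr 1
  simp only [map_mul, Complex.conj_I, Complex.conj_ofReal, Complex.conj_natCast]
  ring

theorem bfMatrix_apply_eq_integral {L : ℕ} (ul uh : ℝ) (l k : Fin L) :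
    bfMatrix L ul uh l k = ∫ u in ul..uh,
      Complex.exp (Complex.I * (((l : ℕ) : ℂ) - ((k : ℕ) : ℂ)) * (u : ℂ)) := by
  by_cases h : l = k
  · simp [bfMatrix, h]
  · have hc : Complex.I * (((l : ℕ) : ℂ) - ((k : ℕ) : ℂ)) ≠ 0 := by
      refine mul_ne_zero Complex.I_ne_zero (sub_ne_zero.mpr ?_)
      exact_mod_cast fun e => h (Fin.ext e)
    rw [integral_exp_mul_complex hc]
    simp [bfMatrix, h]

theorem bfMatrix_isHermitian (L : ℕ) (ul uh : ℝ) : (bfMatrix L ul uh).IsHermitian := by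
  ext l k
  rw [Matrix.conjTranspose_apply, bfMatrix_apply_eq_integral, bfMatrix_apply_eq_integral,
    Complex.star_def]
  have h (u : ℝ) : Complex.exp (Complex.I * (((l : ℕ) : ℂ) - ((k : ℕ) : ℂ)) * (u : ℂ)) =
      (starRingEnd ℂ) (Complex.exp (Complex.I * (((k : ℕ) : ℂ) - ((l : ℕ) : ℂ)) * (u : ℂ))) := by
    rw [← Complex.exp_conj]
    congr 1
    simp only [map_mul, map_sub, Complex.conj_I, Complex.conj_ofReal, Complex.conj_natCast]
    ring
  simp only [h, intervalIntegral, integral_conj, map_sub]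

/-- The beam pattern energy over the region of interest is the quadratic form of `bfMatrix`. -/
theorem ofReal_integral_normSq_beam {L : ℕ} (ul uh : ℝ) (w : Fin L → ℂ) :
    ((∫ u in ul..uh, Complex.normSq (∑ l : Fin L, (starRingEnd ℂ) (w l) *
        Complex.exp (Complex.I * ((l : ℕ) : ℂ) * (u : ℂ))) : ℝ) : ℂ) =
      star w ⬝ᵥ (bfMatrix L ul uh).mulVec w := by
  rw [← intervalIntegral.integral_ofReal]
  simp_rw [ofReal_normSq_sum_conj_mul, conj_exp_mul_exp]
  have hi (l k : Fin L) : IntervalIntegrable (fun u : ℝ => (starRingEnd ℂ) (w l) * w k *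
      Complex.exp (Complex.I * (((l : ℕ) : ℂ) - ((k : ℕ) : ℂ)) * (u : ℂ))) volume ul uh :=
    Continuous.intervalIntegrable (by fun_prop) _ _
  rw [intervalIntegral.integral_finsetSum fun l _ =>
    Continuous.intervalIntegrable (by fun_prop) _ _]
  simp only [dotProduct, Matrix.mulVec, Pi.star_apply, Complex.star_def, Finset.mul_sum]
  refine Finset.sum_congr rfl fun l _ => ?_
  rw [intervalIntegral.integral_finsetSum fun k _ => hi l k]
  refine Finset.sum_congr rfl fun k _ => ?_
  rw [intervalIntegral.integral_const_mul, bfMatrix_apply_eq_integral]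
  ring

theorem star_dotProduct_self_eq {L : ℕ} (w : Fin L → ℂ) :
    star w ⬝ᵥ w = ((∑ l, Complex.normSq (w l) : ℝ) : ℂ) := by
  simp only [dotProduct, Pi.star_apply, Complex.star_def, Complex.ofReal_sum,
    Complex.normSq_eq_conj_mul_self]

open scoped ComplexOrder in
/-- A Hermitian quadratic form is bounded by any upper bound of the eigenvalues. -/
theorem Matrix.IsHermitian.re_dotProduct_mulVec_le {L : ℕ} {A : Matrix (Fin L) (Fin L) ℂ}
    (hA : A.IsHermitian) {μ : ℝ}
    (h_max : ∀ (lam : ℝ) (v : Fin L → ℂ), v ≠ 0 → A.mulVec v = (lam : ℂ) • v → lam ≤ μ)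
    (w : Fin L → ℂ) :
    (star w ⬝ᵥ A.mulVec w).re ≤ μ * ∑ l, Complex.normSq (w l) := by
  have hB : ((μ : ℂ) • (1 : Matrix (Fin L) (Fin L) ℂ) - A).IsHermitian := by
    refine Matrix.IsHermitian.sub ?_ hA
    simp [Matrix.IsHermitian, Matrix.conjTranspose_smul]
  have hpos : ((μ : ℂ) • (1 : Matrix (Fin L) (Fin L) ℂ) - A).PosSemidef := by
    rw [hB.posSemidef_iff_eigenvalues_nonneg]
    intro i
    have hv := hB.mulVec_eigenvectorBasis i
    have hne : (hB.eigenvectorBasis i : Fin L → ℂ) ≠ 0 := fun h =>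
      hB.eigenvectorBasis.toBasis.ne_zero i (by simpa using h)
    rw [Matrix.sub_mulVec, Matrix.smul_mulVec, Matrix.one_mulVec, sub_eq_iff_eq_add,
      ← sub_eq_iff_eq_add'] at hv
    have := h_max (μ - hB.eigenvalues i) _ hne (by
      rw [Complex.ofReal_sub, sub_smul, Complex.coe_smul (hB.eigenvalues i), ← hv])
    simpa using this
  have h := (Complex.le_def.mp (hpos.dotProduct_mulVec_nonneg w)).1
  rw [Matrix.sub_mulVec, Matrix.smul_mulVec, Matrix.one_mulVec, dotProduct_sub, dotProduct_smul,
    star_dotProduct_self_eq, smul_eq_mul, ← Complex.ofReal_mul, Complex.sub_re,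
    Complex.ofReal_re, Complex.zero_re] at h
  linarith

theorem normSq_exp_I_mul (a : ℕ) (u : ℝ) :
    Complex.normSq (Complex.exp (Complex.I * (a : ℂ) * (u : ℂ))) = 1 := by
  have h : Complex.I * (a : ℂ) * (u : ℂ) = ((a * u : ℝ) : ℂ) * Complex.I := by
    push_cast; ring
  rw [Complex.normSq_eq_norm_sq, h, Complex.norm_exp_ofReal_mul_I, one_pow]

theorem integral_effSNR {Ω : Type*} [MeasureSpace Ω] (L Nb P : ℕ) (d : Fin Nb → ℕ)
    (n : ℕ → Ω → ℂ) (x : ℂ) (ul uh : ℝ) (w : Fin L → ℂ) :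
    ∫ u in ul..uh, effSNR L Nb P d n x u w =
      Nb * P * Complex.normSq x * (star w ⬝ᵥ (bfMatrix L ul uh).mulVec w).re /
        noiseEnergy L Nb P d n w := by
  rw [← ofReal_integral_normSq_beam, Complex.ofReal_re, ← intervalIntegral.integral_const_mul,
    ← intervalIntegral.integral_div]
  congr 1
  ext u
  simp only [effSNR, map_mul, normSq_exp_I_mul, Finset.sum_const, Finset.card_univ,
    Fintype.card_fin, nsmul_eq_mul]
  ring

theorem integral_normSq_sum_conj_mul {Ω : Type*} [MeasureSpace Ω] {L : ℕ} {σ : ℝ}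
    (z : Fin L → Ω → ℂ) (h_var : ∀ l, (∫ ω, (Complex.normSq (z l ω) : ℝ)) = σ ^ 2)
    (h_uncorr : ∀ l k, l ≠ k → (∫ ω, (starRingEnd ℂ) (z l ω) * z k ω) = 0)
    (h_int : ∀ l k, Integrable (fun ω => (starRingEnd ℂ) (z l ω) * z k ω))
    (w : Fin L → ℂ) :
    Integrable (fun ω => Complex.normSq (∑ l, (starRingEnd ℂ) (w l) * z l ω)) ∧
      ∫ ω, Complex.normSq (∑ l, (starRingEnd ℂ) (w l) * z l ω) =
        σ ^ 2 * ∑ l, Complex.normSq (w l) := by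
  have hi (l k : Fin L) : Integrable fun ω =>
      (starRingEnd ℂ) (w l) * w k * ((starRingEnd ℂ) (z k ω) * z l ω) :=
    (h_int k l).const_mul _
  have hs (l : Fin L) : Integrable fun ω =>
      ∑ k, (starRingEnd ℂ) (w l) * w k * ((starRingEnd ℂ) (z k ω) * z l ω) :=
    integrable_finsetSum _ fun k _ => hi l k
  constructor
  · have h := (integrable_finsetSum Finset.univ fun l _ => hs l).re
    simp_rw [← ofReal_normSq_sum_conj_mul w fun l => z l _] at h
    simpa using h
  · apply Complex.ofReal_injective
    rw [← integral_complex_ofReal]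
    simp_rw [ofReal_normSq_sum_conj_mul w fun l => z l _]
    rw [integral_finsetSum _ fun l _ => hs l, Complex.ofReal_mul, Complex.ofReal_sum,
      Finset.mul_sum]
    refine Finset.sum_congr rfl fun l _ => ?_
    rw [integral_finsetSum _ fun k _ => hi l k, Finset.sum_eq_single l]
    · rw [integral_const_mul]
      simp_rw [← Complex.normSq_eq_conj_mul_self]
      rw [integral_complex_ofReal, h_var, mul_comm]
    · intro k _ hk
      rw [integral_const_mul, h_uncorr k l hk, mul_zero]
    · simp

theorem noiseEnergy_eq {Ω : Type*} [MeasureSpace Ω] {L N Nb P : ℕ} {σ : ℝ} {n : ℕ → Ω → ℂ}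
    (h_var : ∀ a, a < N → (∫ ω, (Complex.normSq (n a ω) : ℝ)) = σ ^ 2)
    (h_uncorr : ∀ a b, a < N → b < N → a ≠ b →
      (∫ ω, (starRingEnd ℂ) (n a ω) * n b ω) = 0)
    (h_int : ∀ a b, a < N → b < N →
      Integrable (fun ω => (starRingEnd ℂ) (n a ω) * n b ω))
    {d : Fin Nb → ℕ} (h_lt : ∀ (m : Fin Nb) (p : Fin P) (l : Fin L), d m + p + l < N)
    (w : Fin L → ℂ) :
    noiseEnergy L Nb P d n w = Nb * P * σ ^ 2 * ∑ l, Complex.normSq (w l) := by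
  have key (m : Fin Nb) (p : Fin P) := integral_normSq_sum_conj_mul
    (fun l : Fin L => n (d m + p + l)) (fun l => h_var _ (h_lt m p l))
    (fun l k hlk => h_uncorr _ _ (h_lt m p l) (h_lt m p k)
      fun e => hlk (Fin.ext (Nat.add_left_cancel e)))
    (fun l k => h_int _ _ (h_lt m p l) (h_lt m p k)) w
  unfold noiseEnergy
  rw [integral_finsetSum _ fun m _ => integrable_finsetSum _ fun p _ => (key m p).1]
  have (m : Fin Nb) := integral_finsetSum Finset.univ fun (p : Fin P) _ => (key m p).1
  simp only [this, (key _ _).2, Finset.sum_const, Finset.card_univ, Fintype.card_fin,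
    nsmul_eq_mul]
  ring

/-- With a single tap, the noise energy scales as `|w|²` whatever the noise is. -/
theorem noiseEnergy_one_tap {Ω : Type*} [MeasureSpace Ω] (Nb P : ℕ) (d : Fin Nb → ℕ)
    (n : ℕ → Ω → ℂ) (w : Fin 1 → ℂ) :
    noiseEnergy 1 Nb P d n w = noiseEnergy 1 Nb P d n 1 * ∑ l, Complex.normSq (w l) := by
  unfold noiseEnergy
  rw [← integral_mul_const]
  congr 1
  ext ω
  simp only [Finset.univ_unique, Finset.sum_singleton, map_mul, Complex.normSq_conj,
    Pi.one_apply, map_one, one_mul, Finset.sum_mul]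
  exact Finset.sum_congr rfl fun m _ => Finset.sum_congr rfl fun p _ => mul_comm _ _

theorem noiseEnergy_nonneg {Ω : Type*} [MeasureSpace Ω] (L Nb P : ℕ) (d : Fin Nb → ℕ)
    (n : ℕ → Ω → ℂ) (w : Fin L → ℂ) : 0 ≤ noiseEnergy L Nb P d n w :=
  integral_nonneg fun _ => Finset.sum_nonneg fun _ _ => Finset.sum_nonneg fun _ _ =>
    Complex.normSq_nonneg _

/-- The top eigenvector of `A` maximizes the integrated effective SNR over the
angular region of interest `(u_l, u_h)`. -/
theorem shift_domain_beamforming_optimal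
    (L N Nb P : ℕ) (hL : 1 ≤ L) (hNb : 1 ≤ Nb) (hP : 1 ≤ P)
    (ul uh : ℝ) (hu : ul < uh) (σ : ℝ) (hσ : 0 < σ)
    (Ω : Type*) [MeasureSpace Ω] [IsProbabilityMeasure (volume : Measure Ω)]
    (n : ℕ → Ω → ℂ)
    (h_mean : ∀ a, a < N → (∫ ω, n a ω) = 0)
    (h_var : ∀ a, a < N → (∫ ω, (Complex.normSq (n a ω) : ℝ)) = σ ^ 2)
    (h_uncorr : ∀ a b, a < N → b < N → a ≠ b →
      (∫ ω, (starRingEnd ℂ) (n a ω) * n b ω) = 0)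
    (h_int : ∀ a b, a < N → b < N →
      Integrable (fun ω => (starRingEnd ℂ) (n a ω) * n b ω))
    (d : Fin Nb → ℕ) (hd : StrictMono d)
    (h_bound : ∀ m : Fin Nb, d m + P + L - 2 ≤ N - 1)
    (x : ℂ) (hx : x ≠ 0)
    (w : Fin L → ℂ) (hw : w ≠ 0)
    (wo : Fin L → ℂ) (h_unit : ∑ l : Fin L, Complex.normSq (wo l) = 1)
    (μ : ℝ)
    (h_eig : (bfMatrix L ul uh).mulVec wo = (μ : ℂ) • wo)
    (h_max : ∀ (lam : ℝ) (v : Fin L → ℂ), v ≠ 0 →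
      (bfMatrix L ul uh).mulVec v = (lam : ℂ) • v → lam ≤ μ) :
    (∫ u in ul..uh, effSNR L Nb P d n x u w) ≤
      ∫ u in ul..uh, effSNR L Nb P d n x u wo := by
  obtain ⟨c, hc, hE⟩ : ∃ c : ℝ, 0 ≤ c ∧ ∀ v : Fin L → ℂ,
      noiseEnergy L Nb P d n v = c * ∑ l, Complex.normSq (v l) := by
    rcases Nat.eq_zero_or_pos N with hN | hN
    · -- truncated subtraction in `h_bound` leaves only the single-tap case here
      obtain rfl : L = 1 := by
        have := h_bound ⟨0, hNb⟩
        omega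
      exact ⟨_, noiseEnergy_nonneg _ _ _ _ _ _, noiseEnergy_one_tap Nb P d n⟩
    · refine ⟨Nb * P * σ ^ 2, by positivity, noiseEnergy_eq h_var h_uncorr h_int ?_⟩
      intro m p l
      have := h_bound m
      omega
  have hwpos : 0 < ∑ l, Complex.normSq (w l) := by
    obtain ⟨k, hk⟩ := Function.ne_iff.mp hw
    exact Finset.sum_pos' (fun _ _ => Complex.normSq_nonneg _)
      ⟨k, Finset.mem_univ k, Complex.normSq_pos.mpr hk⟩
  have hwo : (star wo ⬝ᵥ (bfMatrix L ul uh).mulVec wo).re = μ := by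
    rw [h_eig, dotProduct_smul, star_dotProduct_self_eq, h_unit]
    simp
  rw [integral_effSNR, integral_effSNR, hE, hE, hwo, h_unit, mul_one, mul_comm c,
    ← div_div]
  refine div_le_div_of_nonneg_right ?_ hc
  rw [div_le_iff₀ hwpos, mul_assoc _ μ]
  exact mul_le_mul_of_nonneg_left
    ((bfMatrix_isHermitian L ul uh).re_dotProduct_mulVec_le h_max w)
    (mul_nonneg (by positivity) (Complex.normSq_nonneg x))
end

section
/- Let s_1,…,s_K ∈ ℝ be such that the complex numbers exp(iπ s_1),…,exp(iπ s_K) are pairwise distinct, and let x ∈ ℂ^K with x_k ≠ 0 for every k. Define z : ℤ → ℂ by z_n = Σ_{k=1}^K x_k exp(iπ n s_k). Let d_1,…,d_{N_b} and δ_1,…,δ_Q be integers such that the set {d_1,…,d_{N_b}} contains K+1 consecutive integers (a ULA segment of length K+1) and the set {δ_1,…,δ_Q} contains K consecutive integers (a ULA segment of length K). Then the spatially smoothed matrix Y ∈ ℂ^{N_b×Q} with entries [Y]_{m,p} = z_{d_m + δ_p} has rank exactly K. -/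
open Complex Matrix

/-- A matrix of samples `∑ k, x k * w k ^ (d m + δ p)` of an exponential sum with `K` distinct
nonzero nodes and nonzero weights has rank `K`, as soon as the row and column shifts both contain
`K` consecutive integers. -/
theorem Matrix.rank_sum_mul_zpow_add {F : Type*} [Field F] {K M N : ℕ}
    {w x : Fin K → F} (hw : Function.Injective w) (hw0 : ∀ k, w k ≠ 0) (hx : ∀ k, x k ≠ 0)
    {d : Fin M → ℤ} {δ : Fin N → ℤ} {a b : ℤ}
    (hd : ∀ t : ℕ, t < K → ∃ m, d m = a + t) (hδ : ∀ t : ℕ, t < K → ∃ p, δ p = b + t) :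
    (Matrix.of fun m p => ∑ k, x k * w k ^ (d m + δ p)).rank = K := by
  choose f hf using fun i : Fin K => hd i i.isLt
  choose g hg using fun i : Fin K => hδ i i.isLt
  apply le_antisymm
  · have hfactor : (Matrix.of fun m p => ∑ k, x k * w k ^ (d m + δ p)) =
        (Matrix.of fun m k => x k * w k ^ d m) * Matrix.of fun k p => w k ^ δ p := by
      ext m p
      simp only [Matrix.mul_apply, Matrix.of_apply]
      exact Finset.sum_congr rfl fun k _ => by rw [zpow_add₀ (hw0 k), mul_assoc]
    rw [hfactor]
    exact (Matrix.rank_mul_le_left _ _).trans (Matrix.rank_le_width _)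
  · have hsub : (Matrix.of fun m p => ∑ k, x k * w k ^ (d m + δ p)).submatrix f g =
        (Matrix.vandermonde w)ᵀ * Matrix.diagonal (fun k => x k * w k ^ (a + b)) *
          Matrix.vandermonde w := by
      ext i j
      rw [Matrix.mul_apply]
      simp only [Matrix.mul_diagonal, Matrix.submatrix_apply, Matrix.of_apply,
        Matrix.transpose_apply, Matrix.vandermonde_apply, hf, hg]
      refine Finset.sum_congr rfl fun k _ => ?_
      simp only [zpow_add₀ (hw0 k), zpow_natCast]
      ring
    have hdet : ((Matrix.of fun m p => ∑ k, x k * w k ^ (d m + δ p)).submatrix f g).det ≠ 0 := by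
      have hV := Matrix.det_vandermonde_ne_zero_iff.mpr hw
      rw [hsub, Matrix.det_mul, Matrix.det_mul, Matrix.det_transpose, Matrix.det_diagonal]
      exact mul_ne_zero (mul_ne_zero hV (Finset.prod_ne_zero_iff.mpr fun k _ =>
        mul_ne_zero (hx k) (zpow_ne_zero _ (hw0 k)))) hV
    calc K = _ := by rw [Matrix.rank_of_det_ne_zero hdet, Fintype.card_fin]
      _ ≤ _ := Matrix.rank_submatrix_le _ f g

/-- If `exp(iπ s_1),…,exp(iπ s_K)` are pairwise distinct, all `x_k ≠ 0`, the sub-array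
`{d_m}` contains a ULA segment of length `K+1` and the shift set `{δ_p}` contains a ULA
segment of length `K`, then the spatially smoothed matrix `[Y]_{m,p} = z_{d_m + δ_p}`
(with `z_n = Σ_k x_k exp(iπ n s_k)`) has rank exactly `K`. -/
theorem spatially_smoothed_matrix_rank
    (K Nb Q : ℕ) (s : Fin K → ℝ)
    (h_dist : Function.Injective fun k : Fin K =>
      Complex.exp (Complex.I * (Real.pi : ℂ) * (s k : ℂ)))
    (x : Fin K → ℂ) (hx : ∀ k, x k ≠ 0)
    (d : Fin Nb → ℤ) (δ : Fin Q → ℤ)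
    (hd : ∃ c : ℤ, ∀ t : ℕ, t ≤ K → ∃ m : Fin Nb, d m = c + t)
    (hδ : ∃ c : ℤ, ∀ t : ℕ, t < K → ∃ p : Fin Q, δ p = c + t) :
    (Matrix.of fun (m : Fin Nb) (p : Fin Q) =>
        ∑ k : Fin K, x k *
          Complex.exp (Complex.I * (Real.pi : ℂ) * ((d m + δ p : ℤ) : ℂ) * (s k : ℂ))).rank
      = K := by
  obtain ⟨a, ha⟩ := hd
  obtain ⟨b, hb⟩ := hδ
  refine Eq.trans ?_ (Matrix.rank_sum_mul_zpow_add h_dist (fun k => Complex.exp_ne_zero _) hx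
    (fun t ht => ha t ht.le) hb)
  congr 1
  ext m p
  simp only [Matrix.of_apply, ← Complex.exp_int_mul]
  refine Finset.sum_congr rfl fun k _ => ?_
  congr 2
  ring
end
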